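/- Every fair division instance with v_i(o) ∈ {-1, 0, 1} for all agents i and items o that is normalized (v_i(O) = K for every agent i, for some constant K) admits an EQ1 allocation. -/

import Mathlib

open Finset

/-- A complete allocation: pairwise disjoint bundles covering all items. -/
def isAllocation {n : ℕ} {ι : Type*} [Fintype ι] [DecidableEq ι]
    (A : Fin n → Finset ι) : Prop :=
  (∀ i j : Fin n, i ≠ j → Disjoint (A i) (A j)) ∧
    Finset.univ.biUnion A = Finset.univ

/-- Equitability up to one item. -/
def EQ1 {n : ℕ} {ι : Type*} [DecidableEq ι]
    (v : Fin n → ι → ℤ) (A : Fin n → Finset ι) : Prop :=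
  ∀ i j : Fin n, ∑ o ∈ A i, v i o < ∑ o ∈ A j, v j o →
    (∃ g ∈ A j, 0 ≤ v j g ∧ ∑ o ∈ (A j).erase g, v j o ≤ ∑ o ∈ A i, v i o) ∨
    (∃ c ∈ A i, v i c ≤ 0 ∧ ∑ o ∈ A j, v j o ≤ ∑ o ∈ (A i).erase c, v i o)


lemma box_hit {α : Type*} (S : Finset α) (y d : α → ℚ) (hy : ∀ c ∈ S, 0 < y c ∧ y c < 1)
    (hd : ∃ c ∈ S, d c ≠ 0) :
    ∃ τ : ℚ, (∀ c ∈ S, 0 ≤ y c + τ * d c ∧ y c + τ * d c ≤ 1) ∧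
      ∃ c ∈ S, y c + τ * d c = 0 ∨ y c + τ * d c = 1 := by
  classical
  obtain ⟨c0, hc0, hd0⟩ := hd
  obtain ⟨c, hc, hmin⟩ := Finset.exists_min_image (S.filter (fun c => d c ≠ 0))
    (fun c => if 0 < d c then (1 - y c) / d c else y c / (- d c)) ⟨c0, by simp [hc0, hd0]⟩
  simp only [Finset.mem_filter] at hc hmin
  obtain ⟨hcS, hdc⟩ := hc
  set τ : ℚ := if 0 < d c then (1 - y c) / d c else y c / (- d c) with hτ
  have hτ0 : 0 ≤ τ := by
    rw [hτ]
    split_ifs with h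
    · exact div_nonneg (by linarith [(hy c hcS).2]) h.le
    · exact div_nonneg (hy c hcS).1.le (by linarith)
  refine ⟨τ, ?_, c, hcS, ?_⟩
  · intro e he
    obtain ⟨h0, h1⟩ := hy e he
    by_cases hde : d e = 0
    · simp [hde, h0.le, h1.le]
    have := hmin e ⟨he, hde⟩
    split_ifs at this with h
    · rw [le_div_iff₀ h] at this
      exact ⟨by nlinarith, by linarith⟩
    · have hneg : d e < 0 := lt_of_le_of_ne (not_lt.mp h) hde
      rw [le_div_iff₀ (by linarith)] at this
      exact ⟨by linarith, by nlinarith⟩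
  · by_cases h : 0 < d c
    · right; rw [hτ, if_pos h]; field_simp; ring
    · left; rw [hτ, if_neg h]; field_simp; ring

lemma exists_ker {α ρ : Type*} [Fintype α] [DecidableEq α] (F : Finset α) (R : Finset ρ)
    (M : ρ → α → ℚ) (h : #R < #F) :
    ∃ d : α → ℚ, (∀ a, a ∉ F → d a = 0) ∧ (∃ a ∈ F, d a ≠ 0) ∧
      ∀ r ∈ R, ∑ a, M r a * d a = 0 := by
  classical
  let L : (F → ℚ) →ₗ[ℚ] (R → ℚ) := Matrix.mulVecLin (fun r a => M r a)
  have hk : LinearMap.ker L ≠ ⊥ := LinearMap.ker_ne_bot_of_finrank_lt (by simpa using h)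
  obtain ⟨e, he, hne⟩ := (Submodule.ne_bot_iff _).1 hk
  obtain ⟨a, ha⟩ := Function.ne_iff.1 hne
  refine ⟨fun a => if h : a ∈ F then e ⟨a, h⟩ else 0, fun a h => by simp [h],
    ⟨a, a.2, by simpa using ha⟩, fun r hr => ?_⟩
  have h1 : ∑ a : F, M r a * e a = 0 := congrFun (LinearMap.mem_ker.1 he) ⟨r, hr⟩
  refine Eq.trans ?_ h1
  rw [← Finset.sum_subset (Finset.subset_univ F) (fun a _ h => by simp [h])]
  rw [← Finset.sum_coe_sort F]
  exact Finset.sum_congr rfl fun a _ => by simp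

/-- sum over the fractional part is an integer -/
lemma frac_sum {β : Type*} [Fintype β] [DecidableEq β] (w : β → ℤ) (x : β → ℚ) (z : ℤ)
    (hs : ∑ b, (w b : ℚ) * x b = z) :
    ∃ z' : ℤ, ∑ b ∈ univ.filter (fun b => (x b ≠ 0 ∧ x b ≠ 1) ∧ w b ≠ 0), (w b : ℚ) * x b = z' := by
  classical
  refine ⟨z - ∑ b ∈ univ.filter (fun b => ¬ ((x b ≠ 0 ∧ x b ≠ 1) ∧ w b ≠ 0)), if x b = 1 then w b else 0, ?_⟩
  rw [← Finset.sum_filter_add_sum_filter_not univ (fun b => (x b ≠ 0 ∧ x b ≠ 1) ∧ w b ≠ 0)] at hs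
  push_cast
  rw [eq_sub_iff_add_eq, ← hs]
  congr 1
  refine Finset.sum_congr rfl fun b hb => ?_
  simp only [mem_filter, mem_univ, true_and, not_and_or, not_not] at hb
  rcases hb with (h | h) | h
  · simp [h]
  · simp [h]
  · simp [h]

lemma deg_two {β : Type*} [Fintype β] [DecidableEq β] (w : β → ℤ) (x : β → ℚ) (z : ℤ)
    (hw : ∀ b, w b = -1 ∨ w b = 0 ∨ w b = 1) (hx : ∀ b, 0 ≤ x b ∧ x b ≤ 1)
    (hs : ∑ b, (w b : ℚ) * x b = z)
    (hne : ∃ b, (x b ≠ 0 ∧ x b ≠ 1) ∧ w b ≠ 0) :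
    2 ≤ #(univ.filter (fun b => (x b ≠ 0 ∧ x b ≠ 1) ∧ w b ≠ 0)) := by
  obtain ⟨z', hz⟩ := frac_sum w x z hs
  obtain ⟨b0, hb0⟩ := hne
  by_contra! hlt
  have hpos : 0 < #(univ.filter (fun b => (x b ≠ 0 ∧ x b ≠ 1) ∧ w b ≠ 0)) :=
    Finset.card_pos.2 ⟨b0, by simpa using hb0⟩
  obtain ⟨a, ha⟩ := Finset.card_eq_one.1 (le_antisymm (Nat.lt_succ_iff.1 hlt) hpos)
  have hma : a ∈ univ.filter (fun b => (x b ≠ 0 ∧ x b ≠ 1) ∧ w b ≠ 0) := by simp [ha]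
  rw [ha, Finset.sum_singleton] at hz
  simp only [mem_filter, mem_univ, true_and] at hma
  have h0 : 0 < x a := lt_of_le_of_ne (hx a).1 (Ne.symm hma.1.1)
  have h1 : x a < 1 := lt_of_le_of_ne (hx a).2 hma.1.2
  rcases hw a with h | h | h
  · rw [h] at hz; push_cast at hz
    have : (z' : ℚ) < 0 := by linarith
    have h2 : (-1 : ℚ) < z' := by linarith
    have : z' < 0 := by exact_mod_cast this
    have : -1 < z' := by exact_mod_cast h2
    omega
  · exact hma.2 h
  · rw [h] at hz; push_cast at hz
    have : (z' : ℚ) < 1 := by linarith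
    have h2 : (0 : ℚ) < z' := by linarith
    have : z' < 1 := by exact_mod_cast this
    have : 0 < z' := by exact_mod_cast h2
    omega

lemma deg_two_half {β : Type*} [Fintype β] [DecidableEq β] (w : β → ℤ) (x : β → ℚ) (z : ℤ)
    (hw : ∀ b, w b = -1 ∨ w b = 0 ∨ w b = 1) (hx : ∀ b, 0 ≤ x b ∧ x b ≤ 1)
    (hs : ∑ b, (w b : ℚ) * x b = z)
    (h2 : #(univ.filter (fun b => (x b ≠ 0 ∧ x b ≠ 1) ∧ w b ≠ 0)) = 2) :
    ∑ b ∈ univ.filter (fun b => (x b ≠ 0 ∧ x b ≠ 1) ∧ w b ≠ 0), (w b : ℚ) * (2 * x b - 1) = 0 := by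
  obtain ⟨z', hz⟩ := frac_sum w x z hs
  obtain ⟨a, c, hac, he⟩ := Finset.card_eq_two.1 h2
  have hma : a ∈ univ.filter (fun b => (x b ≠ 0 ∧ x b ≠ 1) ∧ w b ≠ 0) := by simp [he]
  have hmc : c ∈ univ.filter (fun b => (x b ≠ 0 ∧ x b ≠ 1) ∧ w b ≠ 0) := by simp [he]
  rw [he, Finset.sum_pair hac] at hz ⊢
  simp only [mem_filter, mem_univ, true_and] at hma hmc
  have h0 : 0 < x a := lt_of_le_of_ne (hx a).1 (Ne.symm hma.1.1)
  have h1 : x a < 1 := lt_of_le_of_ne (hx a).2 hma.1.2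
  have h0' : 0 < x c := lt_of_le_of_ne (hx c).1 (Ne.symm hmc.1.1)
  have h1' : x c < 1 := lt_of_le_of_ne (hx c).2 hmc.1.2
  have key : ∀ l : ℤ, (l - 1 : ℚ) < z' → (z' : ℚ) < l + 1 → (z' : ℚ) = l := by
    intro l ha hb
    have ha : l - 1 < z' := by exact_mod_cast ha
    have hb : z' < l + 1 := by exact_mod_cast hb
    have : z' = l := by omega
    exact_mod_cast this
  rcases hw a with h | h | h
  · rcases hw c with h' | h' | h'
    · rw [h, h'] at hz ⊢
      push_cast at hz ⊢
      have := key (-1) (by push_cast; linarith) (by push_cast; linarith)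
      push_cast at this
      linarith
    · exact absurd h' hmc.2
    · rw [h, h'] at hz ⊢
      push_cast at hz ⊢
      have := key 0 (by push_cast; linarith) (by push_cast; linarith)
      push_cast at this
      linarith
  · exact absurd h hma.2
  · rcases hw c with h' | h' | h'
    · rw [h, h'] at hz ⊢
      push_cast at hz ⊢
      have := key 0 (by push_cast; linarith) (by push_cast; linarith)
      push_cast at this
      linarith
    · exact absurd h' hmc.2
    · rw [h, h'] at hz ⊢
      push_cast at hz ⊢
      have := key 1 (by push_cast; linarith) (by push_cast; linarith)
      push_cast at this
      linarith

def Ut {n : ℕ} {ι : Type*} [Fintype ι] (v : Fin n → ι → ℤ) (x : Fin n × ι → ℚ) (i : Fin n) : ℚ :=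
  ∑ o, (v i o : ℚ) * x (i, o)

structure Feas {n : ℕ} {ι : Type*} [Fintype ι] (v : Fin n → ι → ℤ) (k : ℤ)
    (x : Fin n × ι → ℚ) : Prop where
  box : ∀ a, 0 ≤ x a ∧ x a ≤ 1
  item : ∀ o, ∑ i, x (i, o) = 1
  util : ∀ i, (k : ℚ) ≤ Ut v x i ∧ Ut v x i ≤ k + 1

def FF {n : ℕ} {ι : Type*} [Fintype ι] (x : Fin n × ι → ℚ) : Finset (Fin n × ι) :=
  univ.filter (fun a => x a ≠ 0 ∧ x a ≠ 1)

def NT {n : ℕ} {ι : Type*} [Fintype ι] (v : Fin n → ι → ℤ) (k : ℤ)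
    (x : Fin n × ι → ℚ) : Finset (Fin n) :=
  univ.filter (fun i => Ut v x i ≠ k ∧ Ut v x i ≠ k + 1)

def pot {n : ℕ} {ι : Type*} [Fintype ι] (v : Fin n → ι → ℤ) (k : ℤ)
    (x : Fin n × ι → ℚ) : ℕ := 2 * #(FF x) + #(NT v k x)

lemma mem_FF {n : ℕ} {ι : Type*} [Fintype ι] (x : Fin n × ι → ℚ) (a) :
    a ∈ FF x ↔ (x a ≠ 0 ∧ x a ≠ 1) := by simp [FF]

lemma mem_NT {n : ℕ} {ι : Type*} [Fintype ι] (v : Fin n → ι → ℤ) (k : ℤ)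
    (x : Fin n × ι → ℚ) (i) : i ∈ NT v k x ↔ (Ut v x i ≠ k ∧ Ut v x i ≠ k + 1) := by simp [NT]

lemma Ut_add {n : ℕ} {ι : Type*} [Fintype ι] (v : Fin n → ι → ℤ) (x d : Fin n × ι → ℚ) (τ : ℚ)
    (i : Fin n) : Ut v (fun a => x a + τ * d a) i = Ut v x i + τ * Ut v d i := by
  simp only [Ut, Finset.mul_sum, ← Finset.sum_add_distrib]
  exact Finset.sum_congr rfl fun o _ => by ring

lemma move {n : ℕ} {ι : Type*} [Fintype ι] (v : Fin n → ι → ℤ) (k : ℤ)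
    (x d : Fin n × ι → ℚ) (hx : Feas v k x) (hsupp : ∀ a, a ∉ FF x → d a = 0)
    (hne : ∃ a ∈ FF x, d a ≠ 0) (hitem : ∀ o, ∑ i, d (i, o) = 0)
    (hag : ∀ i, i ∉ NT v k x → Ut v d i = 0) :
    ∃ x', Feas v k x' ∧ pot v k x' < pot v k x := by
  classical
  let S : Finset ((Fin n × ι) ⊕ Fin n) := (FF x).disjSum (NT v k x)
  obtain ⟨τ, hbox, hhit⟩ := box_hit S (Sum.elim x (fun i => Ut v x i - k)) (Sum.elim d (Ut v d))
    (by
      rintro (a | i) hc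
      · simp only [S, Finset.inl_mem_disjSum, mem_FF] at hc
        exact ⟨lt_of_le_of_ne (hx.box a).1 (Ne.symm hc.1), lt_of_le_of_ne (hx.box a).2 hc.2⟩
      · simp only [S, Finset.inr_mem_disjSum, mem_NT] at hc
        have h1 := lt_of_le_of_ne (hx.util i).1 (Ne.symm hc.1)
        have h2 := lt_of_le_of_ne (hx.util i).2 hc.2
        simp only [Sum.elim_inr]
        constructor <;> linarith)
    (by
      obtain ⟨a, ha, h⟩ := hne
      exact ⟨Sum.inl a, by simpa [S] using ha, by simpa using h⟩)
  have hF : FF (fun a => x a + τ * d a) ⊆ FF x := by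
    intro a ha
    by_contra h
    have h' := hsupp a h
    rw [mem_FF] at ha h
    simp only [h', mul_zero, add_zero] at ha
    exact h ha
  have hN : NT v k (fun a => x a + τ * d a) ⊆ NT v k x := by
    intro a ha
    by_contra h
    have h' := hag a h
    rw [mem_NT] at ha h
    simp only [Ut_add, h', mul_zero, add_zero] at ha
    exact h ha
  refine ⟨fun a => x a + τ * d a, ⟨?_, ?_, ?_⟩, ?_⟩
  · intro a
    by_cases ha : a ∈ FF x
    · simpa using hbox (Sum.inl a) (by simpa [S] using ha)
    · simpa [hsupp a ha] using hx.box a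
  · intro o
    rw [Finset.sum_add_distrib, ← Finset.mul_sum, hitem, hx.item]; simp
  · intro i
    rw [Ut_add]
    by_cases hi : i ∈ NT v k x
    · have := hbox (Sum.inr i) (by simpa [S] using hi)
      simp only [Sum.elim_inr] at this
      constructor <;> linarith
    · simpa [hag i hi] using hx.util i
  · unfold pot
    obtain ⟨(a | i), hc, h⟩ := hhit
    · have : FF (fun a => x a + τ * d a) ⊂ FF x := by
        refine (Finset.ssubset_iff_of_subset hF).2 ⟨a, by simpa [S] using hc, ?_⟩
        rw [mem_FF]
        simp only [Sum.elim_inl] at h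
        tauto
      have := Finset.card_lt_card this
      have := Finset.card_le_card hN
      omega
    · have : NT v k (fun a => x a + τ * d a) ⊂ NT v k x := by
        refine (Finset.ssubset_iff_of_subset hN).2 ⟨i, by simpa [S] using hc, ?_⟩
        rw [mem_NT, Ut_add]
        simp only [Sum.elim_inr] at h
        rintro ⟨h1, h2⟩
        rcases h with h | h
        · exact h1 (by linarith)
        · exact h2 (by linarith)
      have := Finset.card_lt_card this
      have := Finset.card_le_card hF
      omega

lemma half_move {n : ℕ} {ι : Type*} [Fintype ι] (v : Fin n → ι → ℤ) (k : ℤ)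
    (x d : Fin n × ι → ℚ) (hx : Feas v k x) (hsupp : ∀ a, a ∉ FF x → d a = 0)
    (hne : ∃ a ∈ FF x, d a ≠ 0) (hitem : ∀ o, ∑ i, d (i, o) = 0)
    (hhalf : ∀ a ∈ FF x, x a = 1 / 2)
    (t : Fin n) (ht : t ∉ NT v k x) (hag : ∀ i, i ≠ t → Ut v d i = 0)
    (hbd : ∀ B : ℚ, (∀ a, |d a| ≤ B) → |Ut v d t| ≤ 2 * B) :
    ∃ x', Feas v k x' ∧ pot v k x' < pot v k x := by
  classical
  obtain ⟨a0, ha0, hd0⟩ := hne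
  obtain ⟨b, hb, hmax⟩ := Finset.exists_max_image (FF x) (fun a => |d a|) ⟨a0, ha0⟩
  have hB : 0 < |d b| := lt_of_lt_of_le (abs_pos.2 hd0) (hmax a0 ha0)
  have hall : ∀ a, |d a| ≤ |d b| := by
    intro a
    by_cases ha : a ∈ FF x
    · exact hmax a ha
    · rw [hsupp a ha]; simp
  have hU := hbd _ hall
  -- choose the sign
  obtain ⟨τ, hτ, hτt⟩ : ∃ τ : ℚ, |τ| = 1 / (2 * |d b|) ∧
      ((k : ℚ) ≤ Ut v x t + τ * Ut v d t ∧ Ut v x t + τ * Ut v d t ≤ k + 1) := by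
    have hs0 : 0 ≤ 1 / (2 * |d b|) := by positivity
    have hle : |1 / (2 * |d b|) * Ut v d t| ≤ 1 := by
      rw [abs_mul, abs_of_nonneg hs0, div_mul_eq_mul_div, div_le_one (by positivity)]
      simpa using hU
    rw [mem_NT, not_and_or, not_not, not_not] at ht
    set c := 1 / (2 * |d b|) * Ut v d t with hc
    have hle' := abs_le.1 hle
    have e1 : |1 / (2 * |d b|)| = 1 / (2 * |d b|) := abs_of_nonneg hs0
    have e2 : |-(1 / (2 * |d b|))| = 1 / (2 * |d b|) := by rw [abs_neg, e1]
    rcases ht with h | h <;> rcases le_total 0 c with h0 | h0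
    · exact ⟨_, e1, by rw [← hc]; constructor <;> linarith⟩
    · exact ⟨_, e2, by rw [neg_mul, ← hc]; constructor <;> linarith⟩
    · exact ⟨_, e2, by rw [neg_mul, ← hc]; constructor <;> linarith⟩
    · exact ⟨_, e1, by rw [← hc]; constructor <;> linarith⟩
  have hstep : ∀ a, |τ * d a| ≤ 1 / 2 := by
    intro a
    rw [abs_mul, hτ, div_mul_eq_mul_div, one_mul, div_le_iff₀ (by positivity)]
    linarith [hall a]
  have hstepb : |τ * d b| = 1 / 2 := by
    rw [abs_mul, hτ]; field_simp
  have hF : FF (fun a => x a + τ * d a) ⊂ FF x := by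
    refine (Finset.ssubset_iff_of_subset ?_).2 ⟨b, hb, ?_⟩
    · intro a ha
      by_contra h
      have h' := hsupp a h
      rw [mem_FF] at ha h
      simp only [h', mul_zero, add_zero] at ha
      exact h ha
    · rw [mem_FF, hhalf b hb]
      rintro ⟨h1, h2⟩
      rcases (abs_eq (by norm_num)).1 hstepb with h | h
      · exact h2 (by rw [h]; norm_num)
      · exact h1 (by rw [h]; norm_num)
  have hN : NT v k (fun a => x a + τ * d a) ⊆ insert t (NT v k x) := by
    intro a ha
    by_cases hat : a = t
    · simp [hat]
    · refine Finset.mem_insert_of_mem ?_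
      rw [mem_NT] at ha ⊢
      simpa only [Ut_add, hag a hat, mul_zero, add_zero] using ha
  refine ⟨fun a => x a + τ * d a, ⟨?_, ?_, ?_⟩, ?_⟩
  · intro a
    by_cases ha : a ∈ FF x
    · have := abs_le.1 (hstep a)
      rw [hhalf a ha]
      constructor <;> linarith
    · simpa [hsupp a ha] using hx.box a
  · intro o
    rw [Finset.sum_add_distrib, ← Finset.mul_sum, hitem, hx.item]; simp
  · intro i
    rw [Ut_add]
    by_cases hi : i = t
    · rw [hi]; exact hτt
    · simpa [hag i hi] using hx.util i
  · unfold pot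
    have := Finset.card_lt_card hF
    have := Finset.card_le_card hN
    have := Finset.card_insert_le t (NT v k x)
    omega

lemma ker_dir {n : ℕ} {ι : Type*} [Fintype ι] [DecidableEq ι] (v : Fin n → ι → ℤ)
    (F : Finset (Fin n × ι)) (I : Finset ι) (T : Finset (Fin n)) (h : #I + #T < #F) :
    ∃ d : Fin n × ι → ℚ, (∀ a, a ∉ F → d a = 0) ∧ (∃ a ∈ F, d a ≠ 0) ∧
      (∀ o ∈ I, ∑ i, d (i, o) = 0) ∧ ∀ t ∈ T, Ut v d t = 0 := by
  obtain ⟨d, h1, h2, h3⟩ := exists_ker F (I.disjSum T)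
    (Sum.elim (fun o a => if a.2 = o then 1 else 0) (fun t a => if a.1 = t then (v t a.2 : ℚ) else 0))
    (by rw [Finset.card_disjSum]; exact h)
  refine ⟨d, h1, h2, fun o ho => ?_, fun t ht => ?_⟩
  · have := h3 (Sum.inl o) (by simpa using ho)
    simpa [Fintype.sum_prod_type] using this
  · have := h3 (Sum.inr t) (by simpa using ht)
    simp only [Sum.elim_inr, Fintype.sum_prod_type] at this
    rw [Finset.sum_eq_single t] at this
    · simpa [Ut] using this
    · intro b _ hb; simp [hb]
    · simp

lemma step {n : ℕ} {ι : Type*} [Fintype ι] [DecidableEq ι] (v : Fin n → ι → ℤ) (k : ℤ)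
    (htri : ∀ i o, v i o = -1 ∨ v i o = 0 ∨ v i o = 1)
    (x : Fin n × ι → ℚ) (hx : Feas v k x) (hF : (FF x).Nonempty) :
    ∃ x', Feas v k x' ∧ pot v k x' < pot v k x := by
  classical
  let I : Finset ι := (FF x).image Prod.snd
  let ID : ι → Finset (Fin n) := fun o =>
    univ.filter (fun i => (x (i, o) ≠ 0 ∧ x (i, o) ≠ 1) ∧ (1 : ℤ) ≠ 0)
  let AD : Fin n → Finset ι := fun t =>
    univ.filter (fun o => (x (t, o) ≠ 0 ∧ x (t, o) ≠ 1) ∧ v t o ≠ 0)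
  let T : Finset (Fin n) := univ.filter (fun t => t ∉ NT v k x ∧ (AD t).Nonempty)
  let F' : Finset (Fin n × ι) := (FF x).filter (fun a => a.1 ∉ NT v k x ∧ v a.1 a.2 ≠ 0)
  have htight : ∀ t, t ∉ NT v k x → ∃ z : ℤ, ∑ o, (v t o : ℚ) * x (t, o) = z := by
    intro t ht
    rw [mem_NT, not_and_or, not_not, not_not] at ht
    rcases ht with h | h
    · exact ⟨k, h⟩
    · exact ⟨k + 1, by push_cast; exact h⟩
  have hitem1 : ∀ o, ∑ i, (((fun _ => 1 : Fin n → ℤ) i : ℤ) : ℚ) * x (i, o) = (1 : ℤ) := by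
    intro o; simpa using hx.item o
  have hID : ∀ o ∈ I, 2 ≤ #(ID o) := by
    intro o ho
    obtain ⟨⟨i, o'⟩, ha, rfl⟩ := Finset.mem_image.1 ho
    rw [mem_FF] at ha
    exact deg_two (fun _ => 1) (fun i => x (i, o')) 1 (by simp) (fun i => hx.box _) (hitem1 o')
      ⟨i, ha, by norm_num⟩
  have hAD : ∀ t ∈ T, 2 ≤ #(AD t) := by
    intro t ht
    obtain ⟨ht1, o, ho⟩ := (Finset.mem_filter.1 ht).2
    obtain ⟨z, hz⟩ := htight t ht1
    exact deg_two (v t) (fun o => x (t, o)) z (htri t) (fun i => hx.box _) hz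
      ⟨o, (Finset.mem_filter.1 ho).2⟩
  have hcF : #(FF x) = ∑ o ∈ I, #(ID o) := by
    rw [Finset.card_eq_sum_card_image Prod.snd (FF x)]
    refine Finset.sum_congr rfl fun o _ => ?_
    refine Finset.card_nbij' Prod.fst (fun i => (i, o)) ?_ ?_ ?_ ?_
    · rintro ⟨i, o'⟩ h
      simp only [mem_coe, mem_filter, mem_FF] at h
      obtain ⟨h, rfl⟩ := h
      simpa [ID] using h
    · intro i h
      simpa [ID, mem_FF] using h
    · rintro ⟨i, o'⟩ h
      simp only [mem_coe, mem_filter, mem_FF] at h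
      simp [h.2]
    · intro i h; rfl
  have hcF' : #F' = ∑ t ∈ T, #(AD t) := by
    rw [Finset.card_eq_sum_card_fiberwise (f := Prod.fst) (t := T)]
    · refine Finset.sum_congr rfl fun t ht => ?_
      have ht1 := (Finset.mem_filter.1 ht).2.1
      refine Finset.card_nbij' Prod.snd (fun o => (t, o)) ?_ ?_ ?_ ?_
      · rintro ⟨i, o'⟩ h
        simp only [F', mem_coe, mem_filter, mem_FF] at h
        obtain ⟨⟨h, h'⟩, rfl⟩ := h
        simp only [AD, mem_coe, mem_filter, mem_univ, true_and]
        exact ⟨h, h'.2⟩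
      · intro i h
        simp only [AD, mem_coe, mem_filter, mem_univ, true_and] at h
        simp only [F', mem_coe, mem_filter, mem_FF]
        exact ⟨⟨h.1, ht1, h.2⟩, trivial⟩
      · rintro ⟨i, o'⟩ h
        simp only [mem_coe, mem_filter] at h
        simp [h.2]
      · intro i h; rfl
    · rintro ⟨t, o⟩ h
      simp only [F', mem_coe, mem_filter, mem_FF] at h
      simp only [T, mem_coe, mem_filter, mem_univ, true_and]
      exact ⟨h.2.1, o, by simp only [AD, mem_filter, mem_univ, true_and]; exact ⟨h.1, h.2.2⟩⟩
  have hI2 : ∑ _o ∈ I, 2 ≤ ∑ o ∈ I, #(ID o) := Finset.sum_le_sum hID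
  have hT2 : ∑ _t ∈ T, 2 ≤ ∑ t ∈ T, #(AD t) := Finset.sum_le_sum hAD
  have hF'le : #F' ≤ #(FF x) := Finset.card_le_card (Finset.filter_subset _ _)
  -- item rows outside `I` are automatically fine
  have hIout : ∀ d : Fin n × ι → ℚ, (∀ a, a ∉ FF x → d a = 0) → ∀ o, o ∉ I →
      ∑ i, d (i, o) = 0 := by
    intro d hd o ho
    refine Finset.sum_eq_zero fun i _ => hd _ fun h => ho ?_
    exact Finset.mem_image.2 ⟨_, h, rfl⟩
  by_cases hlt : #I + #T < #(FF x)
  · obtain ⟨d, h1, h2, h3, h4⟩ := ker_dir v (FF x) I T hlt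
    refine move v k x d hx h1 h2 (fun o => ?_) (fun t ht => ?_)
    · by_cases ho : o ∈ I
      · exact h3 o ho
      · exact hIout d h1 o ho
    · by_cases htT : t ∈ T
      · exact h4 t htT
      · refine Finset.sum_eq_zero fun o _ => ?_
        by_cases hv : v t o = 0
        · simp [hv]
        by_cases ho : (t, o) ∈ FF x
        · refine absurd ?_ htT
          simp only [T, mem_filter, mem_univ, true_and]
          refine ⟨ht, o, ?_⟩
          simp only [AD, mem_filter, mem_univ, true_and]
          exact ⟨(mem_FF _ _).1 ho, hv⟩
        · rw [h1 _ ho]; simp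
  · have hI3 : ∑ _o ∈ I, 2 = 2 * #I := by simp [mul_comm]
    have hT3 : ∑ _t ∈ T, 2 = 2 * #T := by simp [mul_comm]
    have hFeq : F' = FF x := Finset.eq_of_subset_of_card_le (Finset.filter_subset _ _) (by omega)
    have hIeq : ∀ o ∈ I, 2 = #(ID o) :=
      (Finset.sum_eq_sum_iff_of_le hID).1 (by omega)
    have hTeq : ∀ t ∈ T, 2 = #(AD t) :=
      (Finset.sum_eq_sum_iff_of_le hAD).1 (by omega)
    have hFT : ∀ t o, (t, o) ∈ FF x → t ∈ T := by
      intro t o h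
      have h' := h
      rw [← hFeq] at h'
      have h' := (Finset.mem_filter.1 h').2
      simp only [T, mem_filter, mem_univ, true_and]
      refine ⟨h'.1, o, ?_⟩
      simp only [AD, mem_filter, mem_univ, true_and]
      exact ⟨(mem_FF _ _).1 h, h'.2⟩
    have hTout : ∀ d : Fin n × ι → ℚ, (∀ a, a ∉ FF x → d a = 0) → ∀ t, t ∉ T →
        Ut v d t = 0 := by
      intro d hd t ht
      refine Finset.sum_eq_zero fun o _ => ?_
      rw [hd _ fun h => ht (hFT _ _ h)]; simp
    have hUsum : ∀ d : Fin n × ι → ℚ, (∀ a, a ∉ FF x → d a = 0) → ∀ t,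
        Ut v d t = ∑ o ∈ AD t, (v t o : ℚ) * d (t, o) := by
      intro d hd t
      refine (Finset.sum_subset (Finset.subset_univ _) fun o _ ho => ?_).symm
      simp only [AD, mem_filter, mem_univ, true_and, not_and_or] at ho
      rcases ho with ho | ho
      · rw [hd _ (fun h => by rw [mem_FF] at h; tauto)]; simp
      · rw [not_not.1 ho]; simp
    have hIsum : ∀ d : Fin n × ι → ℚ, (∀ a, a ∉ FF x → d a = 0) → ∀ o,
        ∑ i, d (i, o) = ∑ i ∈ ID o, d (i, o) := by
      intro d hd o
      refine (Finset.sum_subset (Finset.subset_univ _) fun i _ ho => ?_).symm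
      refine hd _ fun h => ho ?_
      simp only [ID, mem_filter, mem_univ, true_and]
      exact ⟨(mem_FF _ _).1 h, by norm_num⟩
    by_cases hhalf : ∀ a ∈ FF x, x a = 1 / 2
    · obtain ⟨⟨t, o0⟩, ha⟩ := hF
      have htT : t ∈ T := hFT _ _ ha
      have htNT := (Finset.mem_filter.1 htT).2.1
      have hc := Finset.card_erase_of_mem htT
      have hpos : 0 < #T := Finset.card_pos.2 ⟨t, htT⟩
      obtain ⟨d, h1, h2, h3, h4⟩ := ker_dir v (FF x) I (T.erase t) (by omega)
      refine half_move v k x d hx h1 h2 (fun o => ?_) hhalf t htNT (fun i hi => ?_) ?_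
      · by_cases ho : o ∈ I
        · exact h3 o ho
        · exact hIout d h1 o ho
      · by_cases hiT : i ∈ T
        · exact h4 i (Finset.mem_erase.2 ⟨hi, hiT⟩)
        · exact hTout d h1 i hiT
      · intro B hB
        rw [hUsum d h1 t]
        refine (Finset.abs_sum_le_sum_abs _ _).trans ?_
        have : ∀ o ∈ AD t, |(v t o : ℚ) * d (t, o)| ≤ B := by
          intro o _
          have hB' := hB (t, o)
          have hB0 := (abs_nonneg _).trans hB'
          rcases htri t o with h | h | h <;> rw [h] <;> simp [hB', hB0]
        refine (Finset.sum_le_card_nsmul _ _ _ this).trans ?_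
        rw [← hTeq t htT]; simp
    · push Not at hhalf
      obtain ⟨a, ha, hane⟩ := hhalf
      let d : Fin n × ι → ℚ := fun a => if a ∈ FF x then 2 * x a - 1 else 0
      have h1 : ∀ a, a ∉ FF x → d a = 0 := fun a h => by simp [d, h]
      refine move v k x d hx h1 ⟨a, ha, ?_⟩ (fun o => ?_) (fun t ht => ?_)
      · simp only [d, if_pos ha]
        intro h
        exact hane (by linarith)
      · by_cases ho : o ∈ I
        · rw [hIsum d h1 o]
          have := deg_two_half (fun _ => 1) (fun i => x (i, o)) 1 (by simp) (fun i => hx.box _)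
            (hitem1 o) (hIeq o ho).symm
          rw [← this]
          refine Finset.sum_congr rfl fun i hi => ?_
          have : (i, o) ∈ FF x := (mem_FF _ _).2 (Finset.mem_filter.1 hi).2.1
          simp [d, this]
        · exact hIout d h1 o ho
      · by_cases htT : t ∈ T
        · rw [hUsum d h1 t]
          obtain ⟨z, hz⟩ := htight t ht
          have := deg_two_half (v t) (fun o => x (t, o)) z (htri t) (fun i => hx.box _)
            hz (hTeq t htT).symm
          rw [← this]
          refine Finset.sum_congr rfl fun o ho => ?_
          have : (t, o) ∈ FF x := (mem_FF _ _).2 (Finset.mem_filter.1 ho).2.1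
          simp [d, this]
        · exact hTout d h1 t htT

lemma exists_integral {n : ℕ} {ι : Type*} [Fintype ι] [DecidableEq ι] (v : Fin n → ι → ℤ) (k : ℤ)
    (htri : ∀ i o, v i o = -1 ∨ v i o = 0 ∨ v i o = 1) :
    ∀ (N : ℕ) (x : Fin n × ι → ℚ), Feas v k x → pot v k x = N →
      ∃ x', Feas v k x' ∧ FF x' = ∅ := by
  intro N
  induction N using Nat.strong_induction_on with
  | _ N ih =>
    intro x hx hN
    by_cases hF : (FF x).Nonempty
    · obtain ⟨x', hx', hlt⟩ := step v k htri x hx hF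
      exact ih _ (hN ▸ hlt) x' hx' rfl
    · exact ⟨x, hx, Finset.not_nonempty_iff_eq_empty.1 hF⟩

theorem stmt7 {n : ℕ} (hn : 0 < n) {ι : Type*} [Fintype ι] [DecidableEq ι]
    (v : Fin n → ι → ℤ)
    (htri : ∀ i o, v i o = -1 ∨ v i o = 0 ∨ v i o = 1)
    (K : ℤ) (hnorm : ∀ i, ∑ o, v i o = K) :
    ∃ A : Fin n → Finset ι, isAllocation A ∧ EQ1 v A := by
  classical
  have hn' : (0 : ℚ) < n := by exact_mod_cast hn
  have hn1 : (1 : ℚ) ≤ n := by exact_mod_cast hn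
  obtain ⟨k, hk⟩ : ∃ k : ℤ, k = ⌊(K : ℚ) / n⌋ := ⟨_, rfl⟩
  have hstart : Feas v k (fun _ => 1 / (n : ℚ)) := by
    refine ⟨fun a => ⟨by positivity, ?_⟩, fun o => ?_, fun i => ?_⟩
    · rw [div_le_one hn']; exact hn1
    · simp; field_simp
    · have : Ut v (fun _ => 1 / (n : ℚ)) i = K / n := by
        rw [Ut, ← Finset.sum_mul, ← Int.cast_sum, hnorm]; ring
      rw [this, hk]
      exact ⟨Int.floor_le _, (Int.lt_floor_add_one _).le⟩
  obtain ⟨x, hx, hF⟩ := exists_integral v k htri _ _ hstart rfl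
  have h01 : ∀ a, x a = 0 ∨ x a = 1 := by
    intro a
    have : a ∉ FF x := by simp [hF]
    rw [mem_FF] at this
    tauto
  let A : Fin n → Finset ι := fun i => univ.filter (fun o => x (i, o) = 1)
  have hu : ∀ i, k ≤ ∑ o ∈ A i, v i o ∧ ∑ o ∈ A i, v i o ≤ k + 1 := by
    intro i
    have : ((∑ o ∈ A i, v i o : ℤ) : ℚ) = Ut v x i := by
      rw [Ut, Finset.sum_filter]
      push_cast
      refine Finset.sum_congr rfl fun o _ => ?_
      rcases h01 (i, o) with h | h <;> simp [h]
    have h := hx.util i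
    rw [← this] at h
    exact_mod_cast h
  refine ⟨A, ⟨fun i j hij => ?_, ?_⟩, ?_⟩
  · rw [Finset.disjoint_left]
    intro o hi hj
    have hi : x (i, o) = 1 := (Finset.mem_filter.1 hi).2
    have hj : x (j, o) = 1 := (Finset.mem_filter.1 hj).2
    have h1 : ∑ l ∈ ({i, j} : Finset (Fin n)), x (l, o) ≤ ∑ l, x (l, o) :=
      Finset.sum_le_sum_of_subset_of_nonneg (Finset.subset_univ _) fun l _ _ => (hx.box _).1
    rw [Finset.sum_pair hij, hi, hj, hx.item] at h1
    norm_num at h1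
  · ext o
    simp only [A, mem_biUnion, mem_filter, mem_univ, true_and, iff_true]
    by_contra! h
    have := hx.item o
    rw [Finset.sum_eq_zero fun i _ => (h01 (i, o)).resolve_right (h i)] at this
    norm_num at this
  · intro i j hij
    have hi := hu i
    have hj := hu j
    by_cases h0 : 0 < ∑ o ∈ A j, v j o
    · left
      obtain ⟨g, hg, hpos⟩ := Finset.exists_lt_of_sum_lt (s := A j) (f := fun _ => (0 : ℤ))
        (g := fun o => v j o) (by simpa using h0)
      refine ⟨g, hg, hpos.le, ?_⟩
      have := Finset.add_sum_erase (A j) (v j) hg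
      have hpos' : 0 < v j g := hpos
      omega
    · right
      obtain ⟨g, hg, hneg⟩ := Finset.exists_lt_of_sum_lt (s := A i) (g := fun _ => (0 : ℤ))
        (f := fun o => v i o) (by simp; omega)
      refine ⟨g, hg, hneg.le, ?_⟩
      have := Finset.add_sum_erase (A i) (v i) hg
      have hneg' : v i g < 0 := hneg
      omega
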